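/- arXiv:math/0204348 — 2 statements merged into one kernel-verified Lean document; each statement's English description precedes it below -/
import Mathlib

section
/- Let A be a Hopf algebra over a field k and σ a 2-cocycle on A with convolution inverse σ̄. Then for all a ∈ A, σ(a_(1), S(a_(2))) σ̄(S(a_(3)), a_(4)) = ε(a). -/
open TensorProduct

namespace CocycleAntipode

open Coalgebra HopfAlgebra WithConv
open scoped RingTheory.LinearMap

lemma mul_eq_mul_of_inv {M : Type*} [Monoid M] {p p' x m m' n : M} (hp : p' * p = 1)
    (hm : m * m' = 1) (h : x * m = p * n) : p' * x = n * m' := by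
  rw [← mul_one (p' * x), ← hm, ← mul_assoc, mul_assoc p', h, ← mul_assoc, hp, one_mul]

section Coalgebra

variable {k A : Type*} [CommSemiring k] [AddCommMonoid A] [Module k A]

variable (k A) in
/-- The rebracketing `(x ⊗ (y ⊗ z)) ⊗ w ↦ (x ⊗ y) ⊗ (z ⊗ w)`. -/
noncomputable def rebracket : (A ⊗[k] (A ⊗[k] A)) ⊗[k] A →ₗ[k] (A ⊗[k] A) ⊗[k] (A ⊗[k] A) :=
  (TensorProduct.assoc k (A ⊗[k] A) A A).toLinearMap ∘ₗ
    TensorProduct.map (TensorProduct.assoc k A A A).symm.toLinearMap LinearMap.id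

@[simp] lemma rebracket_tmul (x y z w : A) :
    rebracket k A ((x ⊗ₜ (y ⊗ₜ z)) ⊗ₜ w) = (x ⊗ₜ y) ⊗ₜ (z ⊗ₜ w) := rfl

variable [Coalgebra k A]

lemma map_comul_comul_comp_comul :
    TensorProduct.map (comul (R := k) (A := A)) (comul (R := k) (A := A)) ∘ₗ comul =
      rebracket k A ∘ₗ
        TensorProduct.map (TensorProduct.map LinearMap.id comul ∘ₗ comul) LinearMap.id ∘ₗ
          comul := by
  simp only [rebracket, coassoc_simps]

/-- Collapsing the two middle legs of the fourfold coproduct. -/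
lemma map_comul_comul_collapse {M : Type*} [AddCommMonoid M] [Module k M]
    (F : (A ⊗[k] A) ⊗[k] (A ⊗[k] A) →ₗ[k] M)
    (H : A ⊗[k] A →ₗ[k] M)
    (h : ∀ x y w : A, F (rebracket k A ((x ⊗ₜ comul (R := k) y) ⊗ₜ w)) =
      counit (R := k) y • H (x ⊗ₜ w)) :
    F ∘ₗ TensorProduct.map (comul (R := k)) (comul (R := k)) ∘ₗ comul (R := k) =
      H ∘ₗ comul (R := k) := by
  have key : F ∘ₗ rebracket k A ∘ₗ
      TensorProduct.map (TensorProduct.map LinearMap.id comul) LinearMap.id =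
      H ∘ₗ TensorProduct.map ((TensorProduct.rid k A).toLinearMap ∘ₗ
        TensorProduct.map LinearMap.id counit) LinearMap.id := by
    ext x y w
    simp [h, ← TensorProduct.smul_tmul']
  have hrid : ((TensorProduct.rid k A).toLinearMap ∘ₗ
        TensorProduct.map LinearMap.id counit) ∘ₗ comul (R := k) = LinearMap.id := by
    ext a
    have := lTensor_counit_comul (R := k) a
    rw [LinearMap.lTensor] at this
    simp [this]
  calc _ = (F ∘ₗ rebracket k A ∘ₗ
      TensorProduct.map (TensorProduct.map LinearMap.id comul) LinearMap.id) ∘ₗ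
        TensorProduct.map comul LinearMap.id ∘ₗ comul := by
        rw [map_comul_comul_comp_comul]
        simp only [LinearMap.comp_assoc]
        rw [← LinearMap.comp_assoc comul (TensorProduct.map comul LinearMap.id),
          ← TensorProduct.map_comp, LinearMap.id_comp]
    _ = _ := by
        rw [key, LinearMap.comp_assoc,
          ← LinearMap.comp_assoc comul (TensorProduct.map comul LinearMap.id),
          ← TensorProduct.map_comp, hrid, LinearMap.id_comp, TensorProduct.map_id,
          LinearMap.id_comp]

lemma sum_counit_smul_left {a : A} {ι : Type*} (r : Repr k a ι) :
    ∑ i ∈ r.index, counit (R := k) (r.right i) • r.left i = a := by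
  have h := congr(TensorProduct.rid k A $(sum_tmul_counit_eq r))
  simpa only [map_sum, TensorProduct.rid_tmul, one_smul] using h

lemma toConv_comp_mul_toConv_comp {C : Type*} [AddCommMonoid C] [Module k C] [Coalgebra k C]
    {f g : A →ₗ[k] k} (hfg : toConv f * toConv g = 1) (h : C →ₗc[k] A) :
    toConv (f ∘ₗ h.toLinearMap) * toConv (g ∘ₗ h.toLinearMap) = 1 := by
  have := LinearMap.convMul_comp_coalgHom_distrib (toConv f) (toConv g) h
  rw [hfg] at this
  ext c
  have h2 := LinearMap.congr_fun this c
  simp at h2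
  simp [← h2]

end Coalgebra

section Hopf

variable {k A : Type*} [CommSemiring k] [Semiring A] [HopfAlgebra k A]

variable (k A) in
lemma comul_comp_antipode :
    comul ∘ₗ antipode k (A := A) = TensorProduct.map (antipode k) (antipode k) ∘ₗ
      (TensorProduct.comm k A A).toLinearMap ∘ₗ comul := by
  apply WithConv.toConv_injective
  refine (left_inv_eq_right_inv (a := toConv (comul (R := k) (A := A))) ?_
    LinearMap.comul_right_inv).symm
  have h := map_comul_comul_collapse (k := k) (A := A)
    (LinearMap.mul' k (A ⊗[k] A) ∘ₗ
      TensorProduct.map (TensorProduct.map (antipode k) (antipode k) ∘ₗ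
        (TensorProduct.comm k A A).toLinearMap) LinearMap.id)
    (TensorProduct.mk k A A 1 ∘ₗ LinearMap.mul' k A ∘ₗ
      TensorProduct.map (antipode k) LinearMap.id) ?_
  · apply WithConv.ofConv_injective
    have h2 : (LinearMap.mul' k A ∘ₗ TensorProduct.map (antipode k) LinearMap.id) ∘ₗ
        comul = Algebra.linearMap k A ∘ₗ counit (R := k) (A := A) :=
      mul_antipode_rTensor_comul
    simp only [LinearMap.convMul_def, LinearMap.convOne_def, ofConv_toConv]
    rw [LinearMap.comp_assoc (comul (R := k)) _ (TensorProduct.mk k A A 1), h2,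
      LinearMap.comp_assoc, ← LinearMap.comp_assoc _ _ (TensorProduct.map _ _),
      ← TensorProduct.map_comp, LinearMap.id_comp, LinearMap.comp_assoc] at h
    rw [h, ← LinearMap.comp_assoc]
    congr 1
    ext
    simp
  · intro x y w
    have key (t : A ⊗[k] A) :
        LinearMap.mul' k (A ⊗[k] A) (TensorProduct.map
          (TensorProduct.map (antipode k) (antipode k) ∘ₗ (TensorProduct.comm k A A).toLinearMap)
          LinearMap.id (rebracket k A ((x ⊗ₜ t) ⊗ₜ w))) =
        LinearMap.mul' k A ((antipode k).rTensor A t) ⊗ₜ (antipode k x * w) := by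
      induction t with
      | zero => simp
      | tmul y z => simp
      | add t s ht hs => simp only [TensorProduct.tmul_add, TensorProduct.add_tmul, map_add, ht, hs]
    refine (key _).trans ?_
    rw [mul_antipode_rTensor_comul_apply]
    simp [Algebra.algebraMap_eq_smul_one, TensorProduct.smul_tmul']

lemma comul_antipode (a : A) : comul (antipode k a) =
    TensorProduct.map (antipode k) (antipode k) (TensorProduct.comm k A A (comul a)) :=
  LinearMap.congr_fun (comul_comp_antipode k A) a

variable (k A) in
/-- The linear map `a ↦ a₁ ⊗ S(a₂)`. -/
noncomputable def idAntipode : A →ₗ[k] A ⊗[k] A :=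
  TensorProduct.map LinearMap.id (antipode k) ∘ₗ comul

variable (k A) in
lemma map_id_mul_comul_idAntipode :
    TensorProduct.map LinearMap.id (LinearMap.mul' k A) ∘ₗ comul (R := k) ∘ₗ idAntipode k A =
      (TensorProduct.mk k (A ⊗[k] A) A).flip 1 ∘ₗ idAntipode k A := by
  have h := map_comul_comul_collapse (k := k) (A := A)
    (TensorProduct.map LinearMap.id (LinearMap.mul' k A) ∘ₗ
      (TensorProduct.tensorTensorTensorComm k A A A A).toLinearMap ∘ₗ
      TensorProduct.map LinearMap.id (TensorProduct.map (antipode k) (antipode k) ∘ₗ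
        (TensorProduct.comm k A A).toLinearMap))
    ((TensorProduct.mk k (A ⊗[k] A) A).flip 1 ∘ₗ TensorProduct.map LinearMap.id (antipode k)) ?_
  · rw [idAntipode, ← LinearMap.comp_assoc _ _ (LinearMap.flip _ _), ← h]
    simp only [← LinearMap.comp_assoc]
    congr 1
    ext a b
    simp [comul_antipode, TensorProduct.comul_tmul,
      TensorProduct.AlgebraTensorModule.tensorTensorTensorComm_eq]
  · intro x y w
    have key (t : A ⊗[k] A) :
        TensorProduct.map LinearMap.id (LinearMap.mul' k A)
          (TensorProduct.tensorTensorTensorComm k A A A A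
            (TensorProduct.map LinearMap.id (TensorProduct.map (antipode k) (antipode k) ∘ₗ
              (TensorProduct.comm k A A).toLinearMap) (rebracket k A ((x ⊗ₜ t) ⊗ₜ w)))) =
        (x ⊗ₜ antipode k w) ⊗ₜ LinearMap.mul' k A ((antipode k).lTensor A t) := by
      induction t with
      | zero => simp
      | tmul y z => simp
      | add t s ht hs => simp only [TensorProduct.tmul_add, TensorProduct.add_tmul, map_add, ht, hs]
    refine (key _).trans ?_
    rw [mul_antipode_lTensor_comul_apply]
    simp [Algebra.algebraMap_eq_smul_one]

variable (k A) in
/-- The coalgebra map `(a ⊗ b) ⊗ c ↦ ε(c) (a ⊗ b)`. -/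
noncomputable def fst12 : (A ⊗[k] A) ⊗[k] A →ₗc[k] A ⊗[k] A :=
  (Coalgebra.TensorProduct.rid k k (A ⊗[k] A)).toCoalgHom.comp
    (Coalgebra.TensorProduct.map (.id k _) (Coalgebra.counitCoalgHom k A))

variable (k A) in
/-- The coalgebra map `(a ⊗ b) ⊗ c ↦ ε(a) (b ⊗ c)`. -/
noncomputable def snd23 : (A ⊗[k] A) ⊗[k] A →ₗc[k] A ⊗[k] A :=
  ((Coalgebra.TensorProduct.lid k (A ⊗[k] A)).toCoalgHom.comp
    (Coalgebra.TensorProduct.map (Coalgebra.counitCoalgHom k A) (.id k _))).comp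
    (Coalgebra.TensorProduct.assoc k k A A A).toCoalgHom

variable (k A) in
/-- The coalgebra map `(a ⊗ b) ⊗ c ↦ ab ⊗ c`. -/
noncomputable def mul12 : (A ⊗[k] A) ⊗[k] A →ₗc[k] A ⊗[k] A :=
  Coalgebra.TensorProduct.map (Bialgebra.mulCoalgHom k A) (.id k _)

variable (k A) in
/-- The coalgebra map `(a ⊗ b) ⊗ c ↦ a ⊗ bc`. -/
noncomputable def mul23 : (A ⊗[k] A) ⊗[k] A →ₗc[k] A ⊗[k] A :=
  (Coalgebra.TensorProduct.map (.id k _) (Bialgebra.mulCoalgHom k A)).comp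
    (Coalgebra.TensorProduct.assoc k k A A A).toCoalgHom

@[simp] lemma fst12_tmul (a b c : A) :
    fst12 k A ((a ⊗ₜ b) ⊗ₜ c) = counit (R := k) c • (a ⊗ₜ b) := rfl

@[simp] lemma snd23_tmul (a b c : A) :
    snd23 k A ((a ⊗ₜ b) ⊗ₜ c) = counit (R := k) a • (b ⊗ₜ c) := rfl

@[simp] lemma mul12_tmul (a b c : A) :
    mul12 k A ((a ⊗ₜ b) ⊗ₜ c) = (a * b) ⊗ₜ c := rfl

@[simp] lemma mul23_tmul (a b c : A) :
    mul23 k A ((a ⊗ₜ b) ⊗ₜ c) = a ⊗ₜ (b * c) := rfl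

lemma convMul_snd23_fst12 (f g : A ⊗[k] A →ₗ[k] k) (a b c : A) :
    (toConv (f ∘ₗ (snd23 k A).toLinearMap) * toConv (g ∘ₗ (fst12 k A).toLinearMap) :
      WithConv (_ →ₗ[k] k)) ((a ⊗ₜ b) ⊗ₜ c) =
    LinearMap.mul' k k (TensorProduct.map (f ∘ₗ (TensorProduct.mk k A A).flip c)
      (g ∘ₗ TensorProduct.mk k A A a) (comul (R := k) b)) := by
  rw [(((ℛ k a).tmul (ℛ k b)).tmul (ℛ k c)).convMul_apply]
  rw [← (ℛ k b).eq]
  conv_rhs => rw [← sum_counit_smul (ℛ k a), ← sum_counit_smul_left (ℛ k c)]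
  simp only [Repr.tmul_index, Repr.tmul_left, Repr.tmul_right, Finset.sum_product, map_sum]
  simp [TensorProduct.sum_tmul, TensorProduct.tmul_sum]
  rw [Finset.sum_comm]
  refine Finset.sum_congr rfl fun _ _ => Finset.sum_congr rfl fun _ _ =>
    Finset.sum_congr rfl fun _ _ => ?_
  ring

lemma convMul_fst12_mul12 (f g : A ⊗[k] A →ₗ[k] k) (a b c : A) :
    (toConv (f ∘ₗ (fst12 k A).toLinearMap) * toConv (g ∘ₗ (mul12 k A).toLinearMap) :
      WithConv (_ →ₗ[k] k)) ((a ⊗ₜ b) ⊗ₜ c) =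
    LinearMap.mul' k k (TensorProduct.map f (g ∘ₗ TensorProduct.map (LinearMap.mul' k A) LinearMap.id)
      (TensorProduct.assoc k (A ⊗[k] A) (A ⊗[k] A) A
        (TensorProduct.tensorTensorTensorComm k A A A A (comul (R := k) a ⊗ₜ comul (R := k) b)
          ⊗ₜ c))) := by
  rw [(((ℛ k a).tmul (ℛ k b)).tmul (ℛ k c)).convMul_apply]
  rw [← (ℛ k a).eq, ← (ℛ k b).eq]
  conv_rhs => rw [← sum_counit_smul (ℛ k c)]
  simp only [Repr.tmul_index, Repr.tmul_left, Repr.tmul_right, Finset.sum_product_right]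
  simp [TensorProduct.sum_tmul, TensorProduct.tmul_sum, Finset.mul_sum, mul_assoc]

lemma convMul_snd23_mul23 (f g : A ⊗[k] A →ₗ[k] k) (a b c : A) :
    (toConv (f ∘ₗ (snd23 k A).toLinearMap) * toConv (g ∘ₗ (mul23 k A).toLinearMap) :
      WithConv (_ →ₗ[k] k)) ((a ⊗ₜ b) ⊗ₜ c) =
    LinearMap.mul' k k (TensorProduct.map LinearMap.id g (TensorProduct.leftComm k A k A
      (a ⊗ₜ TensorProduct.map f (LinearMap.mul' k A)
        (TensorProduct.tensorTensorTensorComm k A A A A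
          (comul (R := k) b ⊗ₜ comul (R := k) c))))) := by
  rw [(((ℛ k a).tmul (ℛ k b)).tmul (ℛ k c)).convMul_apply]
  rw [← (ℛ k b).eq, ← (ℛ k c).eq]
  conv_rhs => rw [← sum_counit_smul (ℛ k a)]
  simp only [Repr.tmul_index, Repr.tmul_left, Repr.tmul_right, Finset.sum_product_right]
  simp [TensorProduct.sum_tmul, TensorProduct.tmul_sum, ← TensorProduct.smul_tmul', mul_assoc]

lemma convMul_mul23_mul12 (f g : A ⊗[k] A →ₗ[k] k) (u : A ⊗[k] A) (c : A) :
    (toConv (f ∘ₗ (mul23 k A).toLinearMap) * toConv (g ∘ₗ (mul12 k A).toLinearMap) :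
      WithConv (_ →ₗ[k] k)) (u ⊗ₜ c) =
    ∑ i ∈ (ℛ k c).index, LinearMap.mul' k k (TensorProduct.map
      (f ∘ₗ (mul23 k A).toLinearMap ∘ₗ (TensorProduct.mk k (A ⊗[k] A) A).flip ((ℛ k c).left i))
      (g ∘ₗ (TensorProduct.mk k A A).flip ((ℛ k c).right i))
      (TensorProduct.map LinearMap.id (LinearMap.mul' k A) (comul (R := k) u))) := by
  rw [((ℛ k u).tmul (ℛ k c)).convMul_apply, ← (ℛ k u).eq]
  simp only [Repr.tmul_index, Repr.tmul_left, Repr.tmul_right, Finset.sum_product_right, map_sum]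
  rfl

lemma mul23_comp_idAntipode :
    (mul23 k A).toLinearMap ∘ₗ TensorProduct.map (idAntipode k A) LinearMap.id ∘ₗ comul =
      (TensorProduct.mk k A A).flip 1 := by
  have h : (mul23 k A).toLinearMap = TensorProduct.map LinearMap.id (LinearMap.mul' k A) ∘ₗ
      (TensorProduct.assoc k A A A).toLinearMap := rfl
  have h2 : LinearMap.mul' k A ∘ₗ TensorProduct.map (antipode k) LinearMap.id ∘ₗ
        comul = Algebra.linearMap k A ∘ₗ counit (R := k) (A := A) :=
      mul_antipode_rTensor_comul
  have : (mul23 k A).toLinearMap ∘ₗ TensorProduct.map (idAntipode k A) LinearMap.id ∘ₗ comul =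
     TensorProduct.map LinearMap.id (LinearMap.mul' k A ∘ₗ
     TensorProduct.map (antipode k) LinearMap.id ∘ₗ comul) ∘ₗ comul (R := k) := by
    rw [h, idAntipode]
    simp only [coassoc_simps]
  rw [this, h2, ← LinearMap.id_comp (LinearMap.id (R := k) (M := A)), TensorProduct.map_comp,
    LinearMap.comp_assoc, CoassocSimps.map_counit_comp_comul_right]
  ext
  simp

lemma one_tmul_of_conv {σ σb : A ⊗[k] A →ₗ[k] k} (hconv : toConv σb * toConv σ = 1)
    (hσ : ∀ a : A, σ (1 ⊗ₜ a) = counit (R := k) a) (a : A) :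
    σb (1 ⊗ₜ a) = counit (R := k) a := by
  have h := congr($hconv (1 ⊗ₜ a))
  rw [LinearMap.convMul_apply] at h
  conv_lhs => rw [← sum_counit_smul_left (ℛ k a)]
  simpa [TensorProduct.comul_tmul, ← (ℛ k a).eq, TensorProduct.tmul_sum,
    Algebra.TensorProduct.one_def, hσ, mul_comm] using h

end Hopf
end CocycleAntipode

/-- Let `A` be a Hopf algebra over a field `k` and `σ` a 2-cocycle on `A` with
convolution inverse `σ̄`.  Then for all `a ∈ A`,
`σ(a₁, S(a₂)) σ̄(S(a₃), a₄) = ε(a)`, stated as an equality of linear maps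
`A → k`. -/
theorem cocycle_antipode_identity
    (k : Type*) [Field k] (A : Type*) [Ring A] [HopfAlgebra k A]
    (σ σb : A ⊗[k] A →ₗ[k] k)
    -- σb is a convolution inverse of σ (in the dual algebra of the coalgebra A ⊗ A)
    (hconv₁ : LinearMap.mul' k k ∘ₗ TensorProduct.map σ σb ∘ₗ
        (Coalgebra.comul (R := k) (A := A ⊗[k] A)) =
      (Coalgebra.counit (R := k) (A := A ⊗[k] A)))
    (hconv₂ : LinearMap.mul' k k ∘ₗ TensorProduct.map σb σ ∘ₗ
        (Coalgebra.comul (R := k) (A := A ⊗[k] A)) =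
      (Coalgebra.counit (R := k) (A := A ⊗[k] A)))
    -- the 2-cocycle equation σ(a₁,b₁)σ(a₂b₂,c) = σ(b₁,c₁)σ(a,b₂c₂)
    (hcoc : LinearMap.mul' k k ∘ₗ
        TensorProduct.map σ (σ ∘ₗ TensorProduct.map (LinearMap.mul' k A) LinearMap.id) ∘ₗ
        (TensorProduct.assoc k (A ⊗[k] A) (A ⊗[k] A) A).toLinearMap ∘ₗ
        TensorProduct.map
          ((TensorProduct.tensorTensorTensorComm k A A A A).toLinearMap ∘ₗ
            TensorProduct.map (Coalgebra.comul (R := k) (A := A))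
              (Coalgebra.comul (R := k) (A := A)))
          LinearMap.id =
      LinearMap.mul' k k ∘ₗ
        TensorProduct.map LinearMap.id σ ∘ₗ
        (TensorProduct.leftComm k A k A).toLinearMap ∘ₗ
        TensorProduct.map LinearMap.id (TensorProduct.map σ (LinearMap.mul' k A)) ∘ₗ
        TensorProduct.map LinearMap.id
          ((TensorProduct.tensorTensorTensorComm k A A A A).toLinearMap ∘ₗ
            TensorProduct.map (Coalgebra.comul (R := k) (A := A))
              (Coalgebra.comul (R := k) (A := A))) ∘ₗ
        (TensorProduct.assoc k A A A).toLinearMap)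
    -- normalization: σ(a,1) = σ(1,a) = ε(a)
    (hnorm : ∀ a : A, σ (a ⊗ₜ[k] (1 : A)) = Coalgebra.counit (R := k) a ∧
      σ ((1 : A) ⊗ₜ[k] a) = Coalgebra.counit (R := k) a) :
    let S : A →ₗ[k] A := HopfAlgebra.antipode (R := k)
    LinearMap.mul' k k ∘ₗ
        TensorProduct.map (σ ∘ₗ TensorProduct.map LinearMap.id S)
          (σb ∘ₗ TensorProduct.map S LinearMap.id) ∘ₗ
          TensorProduct.map (Coalgebra.comul (R := k) (A := A))
            (Coalgebra.comul (R := k) (A := A)) ∘ₗ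
            (Coalgebra.comul (R := k) (A := A)) =
      (Coalgebra.counit (R := k) (A := A)) := by
  open CocycleAntipode WithConv in
  intro S
  have h₁ : toConv σ * toConv σb = 1 := congr(toConv $hconv₁)
  have h₂ : toConv σb * toConv σ = 1 := congr(toConv $hconv₂)
  have hc : toConv (σ ∘ₗ (fst12 k A).toLinearMap) * toConv (σ ∘ₗ (mul12 k A).toLinearMap) =
      toConv (σ ∘ₗ (snd23 k A).toLinearMap) * toConv (σ ∘ₗ (mul23 k A).toLinearMap) := by
    apply WithConv.ofConv_injective
    refine TensorProduct.ext_threefold fun a b c => ?_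
    refine (convMul_fst12_mul12 σ σ a b c).trans (Eq.trans ?_ (convMul_snd23_mul23 σ σ a b c).symm)
    exact LinearMap.congr_fun hcoc ((a ⊗ₜ b) ⊗ₜ c)
  have hc' : toConv (σb ∘ₗ (snd23 k A).toLinearMap) * toConv (σ ∘ₗ (fst12 k A).toLinearMap) =
      toConv (σ ∘ₗ (mul23 k A).toLinearMap) * toConv (σb ∘ₗ (mul12 k A).toLinearMap) := by
    refine mul_eq_mul_of_inv ?_ ?_ hc
    · exact toConv_comp_mul_toConv_comp h₂ _
    · exact toConv_comp_mul_toConv_comp h₁ _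
  have hσb := one_tmul_of_conv h₂ fun a => (hnorm a).2
  have hL : ofConv (toConv (σb ∘ₗ (snd23 k A).toLinearMap) *
      toConv (σ ∘ₗ (fst12 k A).toLinearMap)) ∘ₗ
        TensorProduct.map (TensorProduct.map LinearMap.id S) LinearMap.id =
      (LinearMap.mul' k k ∘ₗ TensorProduct.map (σ ∘ₗ TensorProduct.map LinearMap.id S)
          (σb ∘ₗ TensorProduct.map S LinearMap.id)) ∘ₗ rebracket k A ∘ₗ
        TensorProduct.map (TensorProduct.map LinearMap.id Coalgebra.comul) LinearMap.id := by
    refine TensorProduct.ext_threefold fun a b c => ?_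
    refine (convMul_snd23_fst12 σb σ a (S b) c).trans ?_
    rw [comul_antipode]
    simp only [LinearMap.comp_apply, TensorProduct.map_tmul, LinearMap.id_apply]
    generalize (Coalgebra.comul (R := k) b) = t
    induction t with
    | zero => simp
    | tmul y z => simp [S, mul_comm]
    | add t s ht hs => simp only [TensorProduct.tmul_add, TensorProduct.add_tmul, map_add, ht, hs]
  have hR : ofConv (toConv (σ ∘ₗ (mul23 k A).toLinearMap) *
      toConv (σb ∘ₗ (mul12 k A).toLinearMap)) ∘ₗ
        TensorProduct.map (idAntipode k A) LinearMap.id =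
      σ ∘ₗ (mul23 k A).toLinearMap ∘ₗ TensorProduct.map (idAntipode k A) LinearMap.id := by
    refine TensorProduct.ext' fun a c => ?_
    refine (convMul_mul23_mul12 σ σb (idAntipode k A a) c).trans ?_
    have := LinearMap.congr_fun (map_id_mul_comul_idAntipode k A) a
    simp only [LinearMap.comp_apply] at this
    rw [this]
    simp only [LinearMap.comp_apply, TensorProduct.map_tmul, LinearMap.id_apply]
    conv_rhs => rw [← sum_counit_smul_left (Coalgebra.Repr.arbitrary k c)]
    simp [hσb, TensorProduct.tmul_sum, mul_comm]
  calc
    _ = (LinearMap.mul' k k ∘ₗ TensorProduct.map (σ ∘ₗ TensorProduct.map LinearMap.id S)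
          (σb ∘ₗ TensorProduct.map S LinearMap.id)) ∘ₗ
        TensorProduct.map Coalgebra.comul Coalgebra.comul ∘ₗ Coalgebra.comul := rfl
    _ = ofConv (toConv (σb ∘ₗ (snd23 k A).toLinearMap) *
          toConv (σ ∘ₗ (fst12 k A).toLinearMap)) ∘ₗ
        TensorProduct.map (idAntipode k A) LinearMap.id ∘ₗ Coalgebra.comul := by
      have hS : TensorProduct.map (idAntipode k A) (LinearMap.id (R := k) (M := A)) =
          TensorProduct.map (TensorProduct.map LinearMap.id S) LinearMap.id ∘ₗ
            TensorProduct.map Coalgebra.comul LinearMap.id := by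
        rw [← TensorProduct.map_comp, LinearMap.id_comp]
        rfl
      have hδ : TensorProduct.map (TensorProduct.map LinearMap.id Coalgebra.comul ∘ₗ
            Coalgebra.comul (R := k) (A := A)) (LinearMap.id (R := k) (M := A)) =
          TensorProduct.map (TensorProduct.map LinearMap.id Coalgebra.comul) LinearMap.id ∘ₗ
            TensorProduct.map Coalgebra.comul LinearMap.id := by
        rw [← TensorProduct.map_comp, LinearMap.id_comp]
      rw [map_comul_comul_comp_comul, hS, hδ]
      simpa only [LinearMap.comp_assoc] using
        congr($hL.symm ∘ₗ TensorProduct.map Coalgebra.comul LinearMap.id ∘ₗ Coalgebra.comul)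
    _ = σ ∘ₗ (mul23 k A).toLinearMap ∘ₗ TensorProduct.map (idAntipode k A) LinearMap.id ∘ₗ
          Coalgebra.comul := by
      rw [hc', ← LinearMap.comp_assoc, hR]
      rfl
    _ = Coalgebra.counit := by
      rw [mul23_comp_idAntipode]
      ext a
      simp [hnorm]
end

section
/- Let A be a Hopf algebra over a field k and σ a 2-cocycle with convolution inverse σ̄. Then the doubly twisted product a · b = σ(a_(1), b_(1)) σ̄(a_(3), b_(3)) a_(2) b_(2) makes the underlying coalgebra of A into a bialgebra _σA_σ̄ (the coalgebra structure of A is unchanged): this product is associative, has unit 1, and Δ and ε are algebra morphisms for it. -/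
open TensorProduct Coalgebra WithConv

section Convolution

variable {R : Type*} [CommSemiring R]
variable {C : Type*} [AddCommMonoid C] [Module R C]
variable {X : Type*} [Semiring X] [Algebra R X]
variable {Y : Type*} [Semiring Y] [Algebra R Y]

/-- A linear form viewed as an `X`-valued map through the unit of `X`. -/
def convUnitMap (X : Type*) [Semiring X] [Algebra R X] (s : WithConv (C →ₗ[R] R)) :
    WithConv (C →ₗ[R] X) :=
  toConv (Algebra.linearMap R X ∘ₗ s.ofConv)

theorem convUnitMap_apply_mul (s : WithConv (C →ₗ[R] R)) (c : C) (x : X) :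
    convUnitMap X s c * x = s c • x := (Algebra.smul_def _ _).symm

theorem mul_convUnitMap_apply (s : WithConv (C →ₗ[R] R)) (c : C) (x : X) :
    x * convUnitMap X s c = s c • x :=
  (Algebra.commutes _ _).symm.trans (Algebra.smul_def _ _).symm

theorem convUnitMap_self (s : WithConv (C →ₗ[R] R)) : convUnitMap R s = s := rfl

theorem algHom_comp_convUnitMap (h : X →ₐ[R] Y) (s : WithConv (C →ₗ[R] R)) :
    toConv (h.toLinearMap ∘ₗ (convUnitMap X s).ofConv) = convUnitMap Y s := by
  ext x
  simp [convUnitMap]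

variable [Coalgebra R C] {D : Type*} [AddCommMonoid D] [Module R D] [Coalgebra R D]

/-- Precomposition with a coalgebra map. -/
def convPrecomp (F : D →ₗc[R] C) (f : WithConv (C →ₗ[R] X)) : WithConv (D →ₗ[R] X) :=
  toConv (f.ofConv ∘ₗ F.toLinearMap)

theorem convPrecomp_mul (F : D →ₗc[R] C) (f g : WithConv (C →ₗ[R] X)) :
    convPrecomp F (f * g) = convPrecomp F f * convPrecomp F g :=
  congrArg toConv (LinearMap.convMul_comp_coalgHom_distrib f g F)

theorem convPrecomp_one (F : D →ₗc[R] C) :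
    convPrecomp F (1 : WithConv (C →ₗ[R] X)) = 1 := by
  ext x
  simp [convPrecomp, LinearMap.convOne_def]

theorem convPrecomp_convUnitMap (F : D →ₗc[R] C) (s : WithConv (C →ₗ[R] R)) :
    convPrecomp F (convUnitMap X s) = convUnitMap X (convPrecomp F s) := rfl

theorem convUnitMap_mul (s t : WithConv (C →ₗ[R] R)) :
    convUnitMap X (s * t) = convUnitMap X s * convUnitMap X t :=
  congrArg toConv (LinearMap.algHom_comp_convMul_distrib (Algebra.ofId R X) s t)

theorem convUnitMap_one : convUnitMap X (1 : WithConv (C →ₗ[R] R)) = 1 := rfl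

/-- The twist `c ↦ s(c₁) g(c₂) t(c₃)`. -/
noncomputable def convTwist (s t : WithConv (C →ₗ[R] R)) (g : WithConv (C →ₗ[R] X)) :
    WithConv (C →ₗ[R] X) :=
  convUnitMap X s * g * convUnitMap X t

theorem convPrecomp_convTwist (F : D →ₗc[R] C) (s t : WithConv (C →ₗ[R] R))
    (g : WithConv (C →ₗ[R] X)) :
    convPrecomp F (convTwist s t g) =
      convTwist (convPrecomp F s) (convPrecomp F t) (convPrecomp F g) := by
  simp only [convTwist, convPrecomp_mul, convPrecomp_convUnitMap]

theorem convTwist_convTwist (s s' t t' : WithConv (C →ₗ[R] R)) (g : WithConv (C →ₗ[R] X)) :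
    convTwist s t (convTwist s' t' g) = convTwist (s * s') (t' * t) g := by
  simp only [convTwist, convUnitMap_mul, mul_assoc]

theorem convTwist_mul {s t : WithConv (C →ₗ[R] R)} (hts : t * s = 1)
    (f g : WithConv (C →ₗ[R] X)) :
    convTwist s t f * convTwist s t g = convTwist s t (f * g) := by
  have h : convUnitMap X t * convUnitMap X s = 1 := by
    rw [← convUnitMap_mul, hts, convUnitMap_one]
  simp only [convTwist, mul_assoc]
  rw [← mul_assoc (convUnitMap X t), h, one_mul]

theorem algHom_comp_convTwist (h : X →ₐ[R] Y) (s t : WithConv (C →ₗ[R] R))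
    (g : WithConv (C →ₗ[R] X)) :
    toConv (h.toLinearMap ∘ₗ (convTwist s t g).ofConv) =
      convTwist s t (toConv (h.toLinearMap ∘ₗ g.ofConv)) := by
  rw [convTwist, LinearMap.algHom_comp_convMul_distrib, toConv_ofConv,
    LinearMap.algHom_comp_convMul_distrib, toConv_ofConv, algHom_comp_convUnitMap,
    algHom_comp_convUnitMap, convTwist]

/-- The coalgebra map `id ⊗ ε : C ⊗ D → C`. -/
noncomputable def coalgFst (R C D : Type*) [CommSemiring R] [AddCommMonoid C] [Module R C]
    [Coalgebra R C] [AddCommMonoid D] [Module R D] [Coalgebra R D] : C ⊗[R] D →ₗc[R] C :=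
  (Coalgebra.TensorProduct.rid R R C).toCoalgHom.comp
    (Coalgebra.TensorProduct.map (CoalgHom.id R C) (counitCoalgHom R D))

/-- The coalgebra map `ε ⊗ id : D ⊗ C → C`. -/
noncomputable def coalgSnd (R D C : Type*) [CommSemiring R] [AddCommMonoid C] [Module R C]
    [Coalgebra R C] [AddCommMonoid D] [Module R D] [Coalgebra R D] : D ⊗[R] C →ₗc[R] C :=
  (Coalgebra.TensorProduct.lid R C).toCoalgHom.comp
    (Coalgebra.TensorProduct.map (counitCoalgHom R D) (CoalgHom.id R C))

theorem coalgFst_tmul (c : C) (d : D) :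
    coalgFst R C D (c ⊗ₜ d) = counit (R := R) d • c := by
  simp [coalgFst]

theorem coalgSnd_tmul (c : C) (d : D) :
    coalgSnd R D C (d ⊗ₜ c) = counit (R := R) d • c := by
  simp [coalgSnd]

theorem convPrecomp_coalgFst_tmul (s : WithConv (C →ₗ[R] R)) (c : C) (d : D) :
    convPrecomp (coalgFst R C D) s (c ⊗ₜ d) = counit (R := R) d * s c :=
  (congrArg s.ofConv (coalgFst_tmul c d)).trans (map_smul _ _ _)

theorem convPrecomp_coalgSnd_tmul (s : WithConv (C →ₗ[R] R)) (c : C) (d : D) :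
    convPrecomp (coalgSnd R D C) s (d ⊗ₜ c) = counit (R := R) d * s c :=
  (congrArg s.ofConv (coalgSnd_tmul c d)).trans (map_smul _ _ _)

theorem convMul_apply_tmul {ι κ : Type*} {c : C} {d : D} (r : Coalgebra.Repr R c ι)
    (r' : Coalgebra.Repr R d κ) (f g : WithConv (C ⊗[R] D →ₗ[R] X)) :
    (f * g) (c ⊗ₜ d) = ∑ i ∈ r.index, ∑ j ∈ r'.index,
      f (r.left i ⊗ₜ r'.left j) * g (r.right i ⊗ₜ r'.right j) := by
  rw [LinearMap.convMul_apply, TensorProduct.comul_tmul, ← r.eq, ← r'.eq]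
  simp only [sum_tmul, tmul_sum, map_sum, AlgebraTensorModule.tensorTensorTensorComm_tmul,
    map_tmul, LinearMap.mul'_apply]
  exact Finset.sum_comm

theorem sum_counit_right_smul {ι : Type*} {d : D} (r : Coalgebra.Repr R d ι) :
    ∑ j ∈ r.index, counit (R := R) (r.right j) • r.left j = d := by
  simpa [-Coalgebra.sum_tmul_counit_eq] using
    congrArg (TensorProduct.rid R D) (Coalgebra.sum_tmul_counit_eq r)

section OneSided

variable {ι : Type*} {c : C} (r : Coalgebra.Repr R c ι) (d : D) (s : WithConv (C →ₗ[R] R))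

theorem convUnitMap_coalgFst_mul_apply (h : WithConv (C ⊗[R] D →ₗ[R] X)) :
    (convUnitMap X (convPrecomp (coalgFst R C D) s) * h) (c ⊗ₜ d) =
      ∑ i ∈ r.index, s (r.left i) • h (r.right i ⊗ₜ d) := by
  rw [convMul_apply_tmul r (ℛ R d)]
  refine Finset.sum_congr rfl fun i _ => ?_
  conv_rhs => rw [← Coalgebra.sum_counit_smul (ℛ R d)]
  simp [convUnitMap_apply_mul, convPrecomp_coalgFst_tmul, tmul_sum, tmul_smul, Finset.smul_sum,
    smul_smul, mul_comm]

theorem mul_convUnitMap_coalgFst_apply (h : WithConv (C ⊗[R] D →ₗ[R] X)) :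
    (h * convUnitMap X (convPrecomp (coalgFst R C D) s)) (c ⊗ₜ d) =
      ∑ i ∈ r.index, s (r.right i) • h (r.left i ⊗ₜ d) := by
  rw [convMul_apply_tmul r (ℛ R d)]
  refine Finset.sum_congr rfl fun i _ => ?_
  conv_rhs => rw [← sum_counit_right_smul (ℛ R d)]
  simp [mul_convUnitMap_apply, convPrecomp_coalgFst_tmul, tmul_sum, tmul_smul, Finset.smul_sum,
    smul_smul, mul_comm]

theorem convUnitMap_coalgSnd_mul_apply (h : WithConv (D ⊗[R] C →ₗ[R] X)) :
    (convUnitMap X (convPrecomp (coalgSnd R D C) s) * h) (d ⊗ₜ c) =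
      ∑ i ∈ r.index, s (r.left i) • h (d ⊗ₜ r.right i) := by
  rw [convMul_apply_tmul (ℛ R d) r, Finset.sum_comm]
  refine Finset.sum_congr rfl fun i _ => ?_
  conv_rhs => rw [← Coalgebra.sum_counit_smul (ℛ R d)]
  simp [convUnitMap_apply_mul, convPrecomp_coalgSnd_tmul, sum_tmul, ← smul_tmul', Finset.smul_sum,
    smul_smul, mul_comm]

theorem mul_convUnitMap_coalgSnd_apply (h : WithConv (D ⊗[R] C →ₗ[R] X)) :
    (h * convUnitMap X (convPrecomp (coalgSnd R D C) s)) (d ⊗ₜ c) =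
      ∑ i ∈ r.index, s (r.right i) • h (d ⊗ₜ r.left i) := by
  rw [convMul_apply_tmul (ℛ R d) r, Finset.sum_comm]
  refine Finset.sum_congr rfl fun i _ => ?_
  conv_rhs => rw [← sum_counit_right_smul (ℛ R d)]
  simp [mul_convUnitMap_apply, convPrecomp_coalgSnd_tmul, sum_tmul, ← smul_tmul', Finset.smul_sum,
    smul_smul, mul_comm]

end OneSided

theorem comp_map_convTwist_id (s t : WithConv (C →ₗ[R] R)) (g : WithConv (C →ₗ[R] X))
    (f : X ⊗[R] D →ₗ[R] Y) :
    toConv (f ∘ₗ map (convTwist s t g).ofConv LinearMap.id) =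
      convTwist (convPrecomp (coalgFst R C D) s) (convPrecomp (coalgFst R C D) t)
        (toConv (f ∘ₗ map g.ofConv LinearMap.id)) := by
  have hl : ∀ g : WithConv (C →ₗ[R] X),
      toConv (f ∘ₗ map (convUnitMap X s * g).ofConv LinearMap.id) =
        convUnitMap Y (convPrecomp (coalgFst R C D) s) *
          toConv (f ∘ₗ map g.ofConv LinearMap.id) := by
    intro g
    ext c d
    have := convUnitMap_coalgFst_mul_apply (ℛ R c) d s (toConv (f ∘ₗ map g.ofConv LinearMap.id))
    refine Eq.trans ?_ this.symm
    simp [-LinearMap.convMul_apply, (ℛ R c).convMul_apply, convUnitMap, ← Algebra.smul_def,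
      sum_tmul, ← smul_tmul']
  have hr : ∀ g : WithConv (C →ₗ[R] X),
      toConv (f ∘ₗ map (g * convUnitMap X t).ofConv LinearMap.id) =
        toConv (f ∘ₗ map g.ofConv LinearMap.id) *
          convUnitMap Y (convPrecomp (coalgFst R C D) t) := by
    intro g
    ext c d
    have := mul_convUnitMap_coalgFst_apply (ℛ R c) d t (toConv (f ∘ₗ map g.ofConv LinearMap.id))
    refine Eq.trans ?_ this.symm
    simp [-LinearMap.convMul_apply, (ℛ R c).convMul_apply, convUnitMap, ← Algebra.commutes,
      ← Algebra.smul_def, sum_tmul, ← smul_tmul']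
  rw [convTwist, hr, hl, convTwist]

theorem comp_map_id_convTwist (s t : WithConv (C →ₗ[R] R)) (g : WithConv (C →ₗ[R] X))
    (f : D ⊗[R] X →ₗ[R] Y) :
    toConv (f ∘ₗ map LinearMap.id (convTwist s t g).ofConv) =
      convTwist (convPrecomp (coalgSnd R D C) s) (convPrecomp (coalgSnd R D C) t)
        (toConv (f ∘ₗ map LinearMap.id g.ofConv)) := by
  have hl : ∀ g : WithConv (C →ₗ[R] X),
      toConv (f ∘ₗ map LinearMap.id (convUnitMap X s * g).ofConv) =
        convUnitMap Y (convPrecomp (coalgSnd R D C) s) *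
          toConv (f ∘ₗ map LinearMap.id g.ofConv) := by
    intro g
    ext d c
    have := convUnitMap_coalgSnd_mul_apply (ℛ R c) d s (toConv (f ∘ₗ map LinearMap.id g.ofConv))
    refine Eq.trans ?_ this.symm
    simp [-LinearMap.convMul_apply, (ℛ R c).convMul_apply, convUnitMap, ← Algebra.smul_def,
      tmul_sum, tmul_smul]
  have hr : ∀ g : WithConv (C →ₗ[R] X),
      toConv (f ∘ₗ map LinearMap.id (g * convUnitMap X t).ofConv) =
        toConv (f ∘ₗ map LinearMap.id g.ofConv) *
          convUnitMap Y (convPrecomp (coalgSnd R D C) t) := by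
    intro g
    ext d c
    have := mul_convUnitMap_coalgSnd_apply (ℛ R c) d t (toConv (f ∘ₗ map LinearMap.id g.ofConv))
    refine Eq.trans ?_ this.symm
    simp [-LinearMap.convMul_apply, (ℛ R c).convMul_apply, convUnitMap, ← Algebra.commutes,
      ← Algebra.smul_def, tmul_sum, tmul_smul]
  rw [convTwist, hr, hl, convTwist]

theorem convPrecomp_coalgFst_mul (s : WithConv (C →ₗ[R] R)) (f : C ⊗[R] D →ₗ[R] R) :
    convPrecomp (coalgFst R C D) s * toConv f =
      toConv (LinearMap.mul' R R ∘ₗ map s.ofConv f ∘ₗ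
        (TensorProduct.assoc R C C D).toLinearMap ∘ₗ map comul LinearMap.id) := by
  ext c d
  refine (convUnitMap_coalgFst_mul_apply (ℛ R c) d s (toConv f)).trans ?_
  simp [← (ℛ R c).eq, sum_tmul]

theorem convPrecomp_coalgSnd_mul (s : WithConv (C →ₗ[R] R)) (g : C →ₗ[R] X)
    (f : D ⊗[R] X →ₗ[R] R) :
    convPrecomp (coalgSnd R D C) s * toConv (f ∘ₗ map LinearMap.id g) =
      toConv (LinearMap.mul' R R ∘ₗ map LinearMap.id f ∘ₗ
        (TensorProduct.leftComm R D R X).toLinearMap ∘ₗ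
        map LinearMap.id (map s.ofConv g) ∘ₗ map LinearMap.id comul) := by
  ext d c
  refine (convUnitMap_coalgSnd_mul_apply (ℛ R c) d s (toConv (f ∘ₗ map LinearMap.id g))).trans ?_
  simp [← (ℛ R c).eq, tmul_sum]

theorem map_comp_comul_eq_convMul (f : WithConv (C →ₗ[R] X)) (g : WithConv (C →ₗ[R] Y)) :
    toConv (map f.ofConv g.ofConv ∘ₗ comul) =
      toConv ((Algebra.TensorProduct.includeLeft : X →ₐ[R] X ⊗[R] Y).toLinearMap ∘ₗ f.ofConv) *
        toConv ((Algebra.TensorProduct.includeRight : Y →ₐ[R] X ⊗[R] Y).toLinearMap ∘ₗ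
          g.ofConv) := by
  ext c
  simp [-LinearMap.convMul_apply, (ℛ R c).convMul_apply, ← (ℛ R c).eq]

end Convolution

section TwistedProduct

variable {R : Type*} [CommSemiring R] {A : Type*} [Semiring A] [Bialgebra R A]
variable {D : Type*} [AddCommMonoid D] [Module R D] [Coalgebra R D]

/-- The doubly twisted product `a · b = s(a₁, b₁) t(a₃, b₃) a₂ b₂`. -/
noncomputable def twistedMul (s t : WithConv (A ⊗[R] A →ₗ[R] R)) : WithConv (A ⊗[R] A →ₗ[R] A) :=
  convTwist s t (toConv (LinearMap.mul' R A))

variable {s t : WithConv (A ⊗[R] A →ₗ[R] R)}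

theorem comul_comp_twistedMul (hts : t * s = 1) :
    comul ∘ₗ (twistedMul s t).ofConv =
      map (twistedMul s t).ofConv (twistedMul s t).ofConv ∘ₗ comul := by
  apply toConv_injective
  rw [map_comp_comul_eq_convMul, twistedMul, algHom_comp_convTwist, algHom_comp_convTwist,
    convTwist_mul hts, ← map_comp_comul_eq_convMul]
  refine (algHom_comp_convTwist (Bialgebra.comulAlgHom R A) s t _).trans ?_
  congr 2
  exact (Bialgebra.mulCoalgHom R A).map_comp_comul.symm

theorem counit_comp_twistedMul (hst : s * t = 1) :
    counit ∘ₗ (twistedMul s t).ofConv = counit (R := R) (A := A ⊗[R] A) := by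
  apply toConv_injective
  refine (algHom_comp_convTwist (Bialgebra.counitAlgHom R A) s t _).trans ?_
  have h : toConv ((Bialgebra.counitAlgHom R A).toLinearMap ∘ₗ LinearMap.mul' R A) =
      (1 : WithConv (A ⊗[R] A →ₗ[R] R)) :=
    congrArg toConv (Bialgebra.mulCoalgHom R A).counit_comp
  rw [ofConv_toConv, h, convTwist, mul_one, convUnitMap_self, convUnitMap_self, hst]
  rfl

/-- The doubly twisted product as a coalgebra map. -/
noncomputable def twistedMulCoalgHom (hst : s * t = 1) (hts : t * s = 1) : A ⊗[R] A →ₗc[R] A where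
  toLinearMap := (twistedMul s t).ofConv
  counit_comp := counit_comp_twistedMul hst
  map_comp_comul := (comul_comp_twistedMul hts).symm

/-- If `F` is a coalgebra map with `s ∘ F = L * q` and `m ∘ F = p * n * q`, where `q` is the
convolution inverse of `p`, then `twistedMul s t ∘ F = L * n * L⁻¹`. -/
theorem exists_convPrecomp_twistedMul_eq (hst : s * t = 1) (hts : t * s = 1)
    (F : D →ₗc[R] A ⊗[R] A) {p q L : WithConv (D →ₗ[R] R)} {n : WithConv (D →ₗ[R] A)}
    (hpq : p * q = 1) (hqp : q * p = 1) (hs : convPrecomp F s = L * q)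
    (hm : convPrecomp F (toConv (LinearMap.mul' R A)) = convTwist p q n) :
    ∃ L' : WithConv (D →ₗ[R] R), L * L' = 1 ∧ L' * L = 1 ∧
      convPrecomp F (twistedMul s t) = convTwist L L' n := by
  have h₁ : convPrecomp F s * convPrecomp F t = 1 := by
    rw [← convPrecomp_mul, hst, convPrecomp_one]
  have h₂ : convPrecomp F t * convPrecomp F s = 1 := by
    rw [← convPrecomp_mul, hts, convPrecomp_one]
  have hL : L = convPrecomp F s * p := by rw [hs, mul_assoc, hqp, mul_one]
  refine ⟨q * convPrecomp F t, ?_, ?_, ?_⟩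
  · rw [hL, mul_assoc, ← mul_assoc p, hpq, one_mul, h₁]
  · rw [hL, mul_assoc, ← mul_assoc _ _ p, h₂, one_mul, hqp]
  · rw [twistedMul, convPrecomp_convTwist, hm, convTwist_convTwist, ← hL]

/-- The doubly twisted product of a 2-cocycle is associative. -/
theorem twistedMul_assoc (hst : s * t = 1) (hts : t * s = 1)
    (hcoc : convPrecomp (coalgFst R (A ⊗[R] A) A) s *
        toConv (s.ofConv ∘ₗ map (LinearMap.mul' R A) LinearMap.id) =
      convPrecomp (Coalgebra.TensorProduct.assoc R R A A A).toCoalgHom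
        (convPrecomp (coalgSnd R A (A ⊗[R] A)) s *
          toConv (s.ofConv ∘ₗ map LinearMap.id (LinearMap.mul' R A)))) (a b c : A) :
    twistedMul s t (twistedMul s t (a ⊗ₜ b) ⊗ₜ c) =
      twistedMul s t (a ⊗ₜ twistedMul s t (b ⊗ₜ c)) := by
  let M := twistedMulCoalgHom hst hts
  let as := (Coalgebra.TensorProduct.assoc R R A A A).toCoalgHom
  have hp : ∀ {E : Type _} [AddCommMonoid E] [Module R E] [Coalgebra R E]
      (P : E →ₗc[R] A ⊗[R] A), convPrecomp P s * convPrecomp P t = 1 ∧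
        convPrecomp P t * convPrecomp P s = 1 := fun P => by
    rw [← convPrecomp_mul, ← convPrecomp_mul, hst, hts, convPrecomp_one]
    exact ⟨rfl, rfl⟩
  let P₁ := coalgFst R (A ⊗[R] A) A
  let P₂ := (coalgSnd R A (A ⊗[R] A)).comp as
  let F₁ := Coalgebra.TensorProduct.map M (CoalgHom.id R A)
  let F₂ := (Coalgebra.TensorProduct.map (CoalgHom.id R A) M).comp as
  obtain ⟨L₁, -, h₁, e₁⟩ := exists_convPrecomp_twistedMul_eq hst hts F₁ (hp P₁).1 (hp P₁).2
    (comp_map_convTwist_id s t _ s.ofConv)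
    (comp_map_convTwist_id s t _ (LinearMap.mul' R A))
  obtain ⟨L₂, h₂, -, e₂⟩ := exists_convPrecomp_twistedMul_eq hst hts F₂ (hp P₂).1 (hp P₂).2
    ((congrArg (convPrecomp as) (comp_map_id_convTwist s t _ s.ofConv)).trans
      (convPrecomp_convTwist _ _ _ _))
    ((congrArg (convPrecomp as) (comp_map_id_convTwist s t _ (LinearMap.mul' R A))).trans
      (convPrecomp_convTwist _ _ _ _))
  rw [convPrecomp_mul] at hcoc
  have hL : L₁ = L₂ := left_inv_eq_right_inv h₁ (by
    refine Eq.trans ?_ h₂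
    exact congrArg (· * L₂) hcoc)
  have hm : toConv (LinearMap.mul' R A ∘ₗ map (LinearMap.mul' R A) LinearMap.id) =
      convPrecomp as (toConv (LinearMap.mul' R A ∘ₗ map LinearMap.id (LinearMap.mul' R A))) := by
    ext x y z
    exact mul_assoc x y z
  have key : convPrecomp F₁ (twistedMul s t) = convPrecomp F₂ (twistedMul s t) := by
    refine e₁.trans (Eq.trans ?_ e₂.symm)
    rw [hL]
    exact congrArg₂ (convTwist · L₂ ·) hcoc hm
  exact congrArg (fun f : WithConv ((A ⊗[R] A) ⊗[R] A →ₗ[R] A) => f ((a ⊗ₜ b) ⊗ₜ c)) key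

/-- If `j` is a coalgebra map with `m ∘ j = id` and
`s ∘ j = ε`, then `twistedMul s t ∘ j = id`. -/
theorem twistedMul_apply_of_section (hst : s * t = 1) (j : A →ₗc[R] A ⊗[R] A)
    (hm : ∀ a, LinearMap.mul' R A (j a) = a) (hs : ∀ a, s (j a) = counit a) (a : A) :
    twistedMul s t (j a) = a := by
  have h₁ : convPrecomp j s = 1 := by
    ext x
    exact hs x
  have h₂ : convPrecomp j t = 1 := by
    have h := convPrecomp_mul j s t
    rwa [hst, convPrecomp_one, h₁, one_mul, eq_comm] at h
  have h : convPrecomp j (twistedMul s t) = toConv LinearMap.id := by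
    rw [twistedMul, convPrecomp_convTwist, h₁, h₂, convTwist, convUnitMap_one, one_mul, mul_one]
    ext x
    exact hm x
  exact congrArg (fun f : WithConv (A →ₗ[R] A) => f a) h

theorem twistedMul_one_tmul (hst : s * t = 1) (hs : ∀ a, s (1 ⊗ₜ a) = counit (R := R) a) (a : A) :
    twistedMul s t (1 ⊗ₜ a) = a := by
  let j : A →ₗc[R] A ⊗[R] A :=
    { TensorProduct.mk R A A 1 with
      counit_comp := by ext; simp
      map_comp_comul := by
        ext x
        simp [← (ℛ R x).eq, tmul_sum, Algebra.TensorProduct.one_def] }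
  exact twistedMul_apply_of_section hst j (fun a => one_mul a) hs a

theorem twistedMul_tmul_one (hst : s * t = 1) (hs : ∀ a, s (a ⊗ₜ 1) = counit (R := R) a) (a : A) :
    twistedMul s t (a ⊗ₜ 1) = a := by
  let j : A →ₗc[R] A ⊗[R] A :=
    { (TensorProduct.mk R A A).flip 1 with
      counit_comp := by ext; simp
      map_comp_comul := by
        ext x
        simp [← (ℛ R x).eq, sum_tmul, Algebra.TensorProduct.one_def] }
  exact twistedMul_apply_of_section hst j (fun a => mul_one a) hs a

/-- The doubly twisted product written with the iterated comultiplication `a ↦ (a₁ ⊗ a₂) ⊗ a₃`. -/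
theorem twistedMul_eq (s t : A ⊗[R] A →ₗ[R] R) :
    (twistedMul (toConv s) (toConv t)).ofConv =
      (TensorProduct.rid R A).toLinearMap ∘ₗ
        map ((TensorProduct.lid R A).toLinearMap ∘ₗ map s (LinearMap.mul' R A) ∘ₗ
              (TensorProduct.tensorTensorTensorComm R A A A A).toLinearMap) t ∘ₗ
          (TensorProduct.tensorTensorTensorComm R (A ⊗[R] A) A (A ⊗[R] A) A).toLinearMap ∘ₗ
            map (map comul LinearMap.id ∘ₗ comul) (map comul LinearMap.id ∘ₗ comul) := by
  ext a b
  refine (convMul_apply_tmul (ℛ R a) (ℛ R b) _ _).trans ?_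
  have h : ∀ x y : A, (convUnitMap A (toConv s) * toConv (LinearMap.mul' R A)) (x ⊗ₜ y) =
      TensorProduct.lid R A (map s (LinearMap.mul' R A)
        (TensorProduct.tensorTensorTensorComm R A A A A (comul x ⊗ₜ comul y))) := fun x y => by
    rw [convMul_apply_tmul (ℛ R x) (ℛ R y)]
    simp only [convUnitMap_apply_mul]
    conv_rhs => rw [← (ℛ R x).eq, ← (ℛ R y).eq, sum_tmul, map_sum]
    simp [tmul_sum]
  simp only [mul_convUnitMap_apply, h]
  simp [← (ℛ R a).eq, ← (ℛ R b).eq, tmul_sum, sum_tmul]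
  exact Finset.sum_comm

end TwistedProduct


/-- **The Schauenburg/Doi twist `_σA_σ̄` is a bialgebra.**  Let `A` be a Hopf
algebra over a field `k` and `σ` a 2-cocycle with convolution inverse `σ̄`.
The doubly twisted product `a · b = σ(a₁,b₁) σ̄(a₃,b₃) a₂b₂` is associative with
unit `1`, and the (unchanged) comultiplication `Δ` and counit `ε` of `A` are
algebra morphisms for it, so that the underlying coalgebra of `A` becomes a
bialgebra `_σA_σ̄`. -/
theorem doubly_twisted_bialgebra
    (k : Type*) [Field k] (A : Type*) [Ring A] [HopfAlgebra k A]
    (σ σb : A ⊗[k] A →ₗ[k] k)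
    -- σb is a convolution inverse of σ (in the dual algebra of the coalgebra A ⊗ A)
    (hconv₁ : LinearMap.mul' k k ∘ₗ TensorProduct.map σ σb ∘ₗ
        (Coalgebra.comul (R := k) (A := A ⊗[k] A)) =
      (Coalgebra.counit (R := k) (A := A ⊗[k] A)))
    (hconv₂ : LinearMap.mul' k k ∘ₗ TensorProduct.map σb σ ∘ₗ
        (Coalgebra.comul (R := k) (A := A ⊗[k] A)) =
      (Coalgebra.counit (R := k) (A := A ⊗[k] A)))
    -- the 2-cocycle equation σ(a₁,b₁)σ(a₂b₂,c) = σ(b₁,c₁)σ(a,b₂c₂)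
    (hcoc : LinearMap.mul' k k ∘ₗ
        TensorProduct.map σ (σ ∘ₗ TensorProduct.map (LinearMap.mul' k A) LinearMap.id) ∘ₗ
        (TensorProduct.assoc k (A ⊗[k] A) (A ⊗[k] A) A).toLinearMap ∘ₗ
        TensorProduct.map
          ((TensorProduct.tensorTensorTensorComm k A A A A).toLinearMap ∘ₗ
            TensorProduct.map (Coalgebra.comul (R := k) (A := A))
              (Coalgebra.comul (R := k) (A := A)))
          LinearMap.id =
      LinearMap.mul' k k ∘ₗ
        TensorProduct.map LinearMap.id σ ∘ₗ
        (TensorProduct.leftComm k A k A).toLinearMap ∘ₗ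
        TensorProduct.map LinearMap.id (TensorProduct.map σ (LinearMap.mul' k A)) ∘ₗ
        TensorProduct.map LinearMap.id
          ((TensorProduct.tensorTensorTensorComm k A A A A).toLinearMap ∘ₗ
            TensorProduct.map (Coalgebra.comul (R := k) (A := A))
              (Coalgebra.comul (R := k) (A := A))) ∘ₗ
        (TensorProduct.assoc k A A A).toLinearMap)
    -- normalization: σ(a,1) = σ(1,a) = ε(a)
    (hnorm : ∀ a : A, σ (a ⊗ₜ[k] (1 : A)) = Coalgebra.counit (R := k) a ∧
      σ ((1 : A) ⊗ₜ[k] a) = Coalgebra.counit (R := k) a) :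
    -- iterated comultiplication a ↦ (a₁ ⊗ a₂) ⊗ a₃
    let Δ₃ : A →ₗ[k] (A ⊗[k] A) ⊗[k] A :=
      TensorProduct.map (Coalgebra.comul (R := k) (A := A)) LinearMap.id ∘ₗ
        (Coalgebra.comul (R := k) (A := A))
    -- the doubly twisted product  a · b = σ(a₁,b₁) σ̄(a₃,b₃) a₂b₂
    let mul2 : A ⊗[k] A →ₗ[k] A :=
      (TensorProduct.rid k A).toLinearMap ∘ₗ
        TensorProduct.map
          ((TensorProduct.lid k A).toLinearMap ∘ₗ
            TensorProduct.map σ (LinearMap.mul' k A) ∘ₗ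
              (TensorProduct.tensorTensorTensorComm k A A A A).toLinearMap) σb ∘ₗ
          (TensorProduct.tensorTensorTensorComm k (A ⊗[k] A) A (A ⊗[k] A) A).toLinearMap ∘ₗ
            TensorProduct.map Δ₃ Δ₃
    (∀ a b c : A, mul2 (mul2 (a ⊗ₜ[k] b) ⊗ₜ[k] c) = mul2 (a ⊗ₜ[k] mul2 (b ⊗ₜ[k] c))) ∧
      (∀ a : A, mul2 ((1 : A) ⊗ₜ[k] a) = a ∧ mul2 (a ⊗ₜ[k] (1 : A)) = a) ∧
      -- Δ is multiplicative for the twisted product (componentwise product on A ⊗ A)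
      ((Coalgebra.comul (R := k) (A := A)) ∘ₗ mul2 =
        TensorProduct.map mul2 mul2 ∘ₗ
          (TensorProduct.tensorTensorTensorComm k A A A A).toLinearMap ∘ₗ
            TensorProduct.map (Coalgebra.comul (R := k) (A := A))
              (Coalgebra.comul (R := k) (A := A))) ∧
      ((Coalgebra.comul (R := k) (A := A)) (1 : A) = (1 : A) ⊗ₜ[k] (1 : A)) ∧
      -- ε is multiplicative for the twisted product
      ((Coalgebra.counit (R := k) (A := A)) ∘ₗ mul2 =
        LinearMap.mul' k k ∘ₗ
          TensorProduct.map (Coalgebra.counit (R := k) (A := A))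
            (Coalgebra.counit (R := k) (A := A))) ∧
      ((Coalgebra.counit (R := k) (A := A)) (1 : A) = 1) := by
  intro Δ₃ mul2
  have hst : toConv σ * toConv σb = 1 := congrArg toConv hconv₁
  have hts : toConv σb * toConv σ = 1 := congrArg toConv hconv₂
  have hmul : mul2 = (twistedMul (toConv σ) (toConv σb)).ofConv := (twistedMul_eq σ σb).symm
  rw [hmul]
  refine ⟨twistedMul_assoc hst hts ?_,
    fun a => ⟨twistedMul_one_tmul hst (fun a => (hnorm a).2) a,
      twistedMul_tmul_one hst (fun a => (hnorm a).1) a⟩,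
    comul_comp_twistedMul hts, Bialgebra.comul_one, ?_, Bialgebra.counit_one⟩
  · rw [convPrecomp_coalgFst_mul, convPrecomp_coalgSnd_mul]
    exact congrArg toConv hcoc
  · rw [counit_comp_twistedMul hst]
    ext a b
    simp [mul_comm]
end
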